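/- arXiv:2010.12229 — 2 statements merged into one kernel-verified Lean document; each statement's English description precedes it below -/
import Mathlib

section
/- Let V be a finite set of N ≥ 2 vertices, with constants s ≥ 0 and M > 0, node functions T_c : V → ℝ≥0, C_UP(i) > 0, C_DN(i) > 0, latencies l : V × V → ℝ≥0 and available bandwidths A(i,j) > 0. For a spanning subdigraph G of the complete digraph on V, the delay of arc (i,j) is d_o^G(i,j) = s·T_c(i) + l(i,j) + M / min( C_UP(i)/outdeg_G(i), C_DN(j)/indeg_G(j), A(i,j) ). Let d'(i,j) = s·T_c(i) + l(i,j) + M / min( C_UP(i), C_DN(j), A(i,j) ), and assume d' is symmetric and satisfies the triangle inequality. Let τ* be the minimum, over strongly connected spanning subdigraphs G, of the cycle time of G with delays d_o^G. Then every Hamiltonian cycle Ĉ whose total d'-delay satisfies d'(Ĉ) ≤ (3/2)·min over Hamiltonian cycles C of d'(C) has cycle time (as an overlay, where d_o^Ĉ = d') equal to d'(Ĉ)/N, and d'(Ĉ)/N ≤ 3N·τ*. -/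
/-- The list of cyclically-consecutive ordered pairs of a list
`[i₁, …, iₚ]`, namely `[(i₁,i₂), (i₂,i₃), …, (iₚ,i₁)]`. -/
def cyclicPairs {V : Type*} (l : List V) : List (V × V) := l.zip (l.rotate 1)

/-- `c` is an elementary circuit of the digraph with arc relation `A`:
a list of at least two pairwise-distinct vertices whose cyclically
consecutive pairs are all arcs of `A`. -/
def IsElemCircuit {V : Type*} (A : V → V → Prop) (c : List V) : Prop :=
  2 ≤ c.length ∧ c.Nodup ∧ ∀ p ∈ cyclicPairs c, A p.1 p.2

/-- The total delay `d(γ)` of a circuit, i.e. the sum of the delays of its arcs. -/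
def circuitDelay {V : Type*} (d : V → V → ℝ) (c : List V) : ℝ :=
  ((cyclicPairs c).map fun p => d p.1 p.2).sum

/-- The cycle time of a digraph: the maximum over elementary circuits γ of d(γ)/|γ|. -/
noncomputable def cycleTime {V : Type*} (A : V → V → Prop) (d : V → V → ℝ) : ℝ :=
  sSup {x : ℝ | ∃ c : List V, IsElemCircuit A c ∧ x = circuitDelay d c / (c.length : ℝ)}

/-- A digraph is strongly connected if every vertex can reach every other vertex. -/
def StronglyConnected {V : Type*} (A : V → V → Prop) : Prop :=
  ∀ i j : V, Relation.ReflTransGen A i j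

/-- A Hamiltonian cycle of the complete digraph on a finite vertex type:
a list of pairwise-distinct vertices containing every vertex. -/
def IsHamCycle {V : Type*} (c : List V) : Prop := c.Nodup ∧ ∀ v : V, v ∈ c

section CyclicPairs

variable {V : Type*}

theorem cyclicPairs_cons (a : V) (l : List V) :
    cyclicPairs (a :: l) = (a :: l).zip (l ++ [a]) := by
  simp [cyclicPairs]

theorem length_cyclicPairs (l : List V) : (cyclicPairs l).length = l.length := by
  simp [cyclicPairs]

theorem map_fst_cyclicPairs (l : List V) : (cyclicPairs l).map Prod.fst = l :=
  List.map_fst_zip (by simp)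

theorem map_snd_cyclicPairs (l : List V) : (cyclicPairs l).map Prod.snd = l.rotate 1 :=
  List.map_snd_zip (by simp)

theorem cyclicPairs_rotate (l : List V) (n : ℕ) :
    cyclicPairs (l.rotate n) = (cyclicPairs l).rotate n := by
  simp only [cyclicPairs, List.zip]
  rw [List.zipWith_rotate_distrib _ _ _ _ (by simp), List.rotate_rotate, List.rotate_rotate,
    Nat.add_comm]

theorem cyclicPairs_perm_of_isRotated {l l' : List V} (h : l ~r l') :
    (cyclicPairs l).Perm (cyclicPairs l') := by
  obtain ⟨n, rfl⟩ := h
  rw [cyclicPairs_rotate]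
  exact (List.rotate_perm _ _).symm

theorem circuitDelay_eq_of_perm (d : V → V → ℝ) {l l' : List V}
    (h : (cyclicPairs l).Perm (cyclicPairs l')) : circuitDelay d l = circuitDelay d l' :=
  (h.map _).sum_eq

theorem exists_isRotated_cons {x : V} {l : List V} (h : x ∈ l) : ∃ t, l ~r (x :: t) := by
  obtain ⟨s, t, rfl⟩ := List.append_of_mem h
  exact ⟨t ++ s, by simpa using List.isRotated_append (l := s) (l' := x :: t)⟩

theorem nodup_cyclicPairs {l : List V} (h : l.Nodup) : (cyclicPairs l).Nodup :=
  List.Nodup.of_map Prod.fst (by rwa [map_fst_cyclicPairs])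

theorem exists_mem_cyclicPairs_left {l : List V} {x : V} (h : x ∈ l) :
    ∃ y ∈ l, (x, y) ∈ cyclicPairs l := by
  rw [← map_fst_cyclicPairs l, List.mem_map] at h
  obtain ⟨⟨a, b⟩, hp, rfl⟩ := h
  exact ⟨b, by simpa using (List.of_mem_zip hp).2, hp⟩

theorem exists_mem_cyclicPairs_right {l : List V} {x : V} (h : x ∈ l) :
    ∃ y, (y, x) ∈ cyclicPairs l := by
  rw [← List.mem_rotate (n := 1), ← map_snd_cyclicPairs l, List.mem_map] at h
  obtain ⟨⟨a, b⟩, hp, rfl⟩ := h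
  exact ⟨a, hp⟩

theorem eq_of_mem_cyclicPairs_left {l : List V} (hl : l.Nodup) {x y z : V}
    (hy : (x, y) ∈ cyclicPairs l) (hz : (x, z) ∈ cyclicPairs l) : y = z := by
  rw [← map_fst_cyclicPairs l] at hl
  simpa using List.inj_on_of_nodup_map hl hy hz rfl

theorem eq_of_mem_cyclicPairs_right {l : List V} (hl : l.Nodup) {x y z : V}
    (hy : (y, x) ∈ cyclicPairs l) (hz : (z, x) ∈ cyclicPairs l) : y = z := by
  rw [← List.nodup_rotate (n := 1), ← map_snd_cyclicPairs l] at hl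
  simpa using List.inj_on_of_nodup_map hl hy hz rfl

theorem forall_mem_zip_iff_isChain (r : V → V → Prop) (a b : V) (l : List V) :
    (∀ p ∈ (a :: l).zip (l ++ [b]), r p.1 p.2) ↔ List.IsChain r (a :: (l ++ [b])) := by
  induction l generalizing a with
  | nil => simp
  | cons c l ih =>
    rw [List.cons_append, List.zip_cons_cons, List.forall_mem_cons, ih, List.isChain_cons_cons]

theorem getLast_mem_zip (a b : V) (l : List V) :
    ((a :: l).getLast (by simp), b) ∈ (a :: l).zip (l ++ [b]) := by
  induction l generalizing a with
  | nil => simp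
  | cons c l ih =>
    rw [List.cons_append, List.zip_cons_cons, List.getLast_cons (by simp)]
    exact List.mem_cons_of_mem _ (ih c)

/-- A nonempty set of vertices closed under the successor of a cycle contains the cycle. -/
theorem mem_of_forall_cyclicPairs {l : List V} {S : Set V} {x : V} (hxl : x ∈ l) (hxS : x ∈ S)
    (hS : ∀ p ∈ cyclicPairs l, p.1 ∈ S → p.2 ∈ S) {v : V} (hv : v ∈ l) : v ∈ S := by
  obtain ⟨t, ht⟩ := exists_isRotated_cons hxl
  have hS' : ∀ p ∈ (x :: t).zip (t ++ [x]), p.1 ∈ S → p.2 ∈ S := fun p hp =>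
    hS p ((cyclicPairs_perm_of_isRotated ht).mem_iff.2 (by rwa [cyclicPairs_cons]))
  rw [forall_mem_zip_iff_isChain (fun a b => a ∈ S → b ∈ S)] at hS'
  refine hS'.induction (p := (· ∈ S)) _ (fun _ _ h => h) (by simpa using hxS) v ?_
  have := ht.mem_iff.1 hv
  simp only [List.mem_cons, List.mem_append] at this ⊢
  tauto

theorem circuitDelay_nonneg {d : V → V → ℝ} (hd : ∀ i j, 0 ≤ d i j) (c : List V) :
    0 ≤ circuitDelay d c := by
  apply List.sum_nonneg
  simp only [List.mem_map]
  rintro _ ⟨p, -, rfl⟩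
  exact hd _ _

theorem le_circuitDelay {d : V → V → ℝ} (hd : ∀ i j, 0 ≤ d i j) {c : List V} {i j : V}
    (h : (i, j) ∈ cyclicPairs c) : d i j ≤ circuitDelay d c := by
  apply List.single_le_sum
  · simp only [List.mem_map]
    rintro _ ⟨p, -, rfl⟩
    exact hd _ _
  · exact List.mem_map_of_mem (f := fun p : V × V => d p.1 p.2) h

/-- Inserting `v` after `u` in a cycle with at least two vertices increases the length by at most
twice the distance from `u` to `v`. -/
theorem circuitDelay_insert_le {d : V → V → ℝ} (hsymm : ∀ i j, d i j = d j i)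
    (htri : ∀ i j k, i ≠ j → i ≠ k → j ≠ k → d i j ≤ d i k + d k j) {u v w : V} {t : List V}
    (hnd : (u :: v :: w :: t).Nodup) :
    circuitDelay d (u :: v :: w :: t) ≤ circuitDelay d (u :: w :: t) + 2 * d u v := by
  simp only [List.nodup_cons, List.mem_cons, not_or] at hnd
  have h := htri v w u hnd.2.1.1 (Ne.symm hnd.1.1) (Ne.symm hnd.1.2.1)
  simp only [circuitDelay, cyclicPairs_cons, List.cons_append, List.zip_cons_cons, List.map_cons,
    List.sum_cons]
  linarith [hsymm u v]

/-- In a strongly connected digraph some arc leaves every proper nonempty set of vertices. -/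
theorem StronglyConnected.exists_leaving {A : V → V → Prop} (hA : StronglyConnected A) {S : Set V}
    {x y : V} (hx : x ∈ S) (hy : y ∉ S) : ∃ u ∈ S, ∃ v ∉ S, A u v := by
  by_contra! h
  refine hy ?_
  induction hA x y with
  | refl => exact hx
  | tail _ hbc ih =>
    by_contra hc
    exact h _ (by_contra fun hb => hb (ih hb)) _ hc hbc

theorem exists_nodup_isChain_of_reflTransGen {r : V → V → Prop} {a b : V}
    (h : Relation.ReflTransGen r a b) :
    ∃ l, List.IsChain r (a :: l) ∧ (a :: l).Nodup ∧ (a :: l).getLast (by simp) = b := by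
  induction h using Relation.ReflTransGen.head_induction_on with
  | refl => exact ⟨[], by simp⟩
  | @head a c hac _ ih =>
    obtain ⟨l, hch, hnd, hlast⟩ := ih
    by_cases ha : a ∈ c :: l
    · obtain ⟨s, t, hst⟩ := List.append_of_mem ha
      refine ⟨t, ?_, ?_, ?_⟩
      · rw [hst] at hch
        exact hch.right_of_append
      · rw [hst] at hnd
        exact hnd.of_append_right
      · rw [← hlast]
        simp [hst]
    · exact ⟨c :: l, List.isChain_cons_cons.2 ⟨hac, hch⟩, List.nodup_cons.2 ⟨ha, hnd⟩, by
        rwa [List.getLast_cons (by simp)]⟩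

/-- In a strongly connected loopless digraph every arc lies on an elementary circuit. -/
theorem StronglyConnected.exists_circuit {A : V → V → Prop} (hA : StronglyConnected A) {i j : V}
    (hij : A i j) (hne : i ≠ j) : ∃ c, IsElemCircuit A c ∧ (i, j) ∈ cyclicPairs c := by
  obtain ⟨l, hch, hnd, hlast⟩ := exists_nodup_isChain_of_reflTransGen (hA j i)
  refine ⟨j :: l, ⟨?_, hnd, ?_⟩, ?_⟩
  · cases l with
    | nil => exact absurd hlast.symm hne
    | cons _ _ => simp
  · rw [cyclicPairs_cons, forall_mem_zip_iff_isChain, ← List.cons_append]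
    refine hch.append (List.isChain_singleton _) ?_
    rw [List.getLast?_eq_getLast_of_ne_nil (by simp), hlast]
    simpa using hij
  · rw [cyclicPairs_cons, ← hlast]
    exact getLast_mem_zip j j l

theorem IsHamCycle.ncard_succ {c : List V} (hc : IsHamCycle c) (i : V) :
    {x | (i, x) ∈ cyclicPairs c}.ncard = 1 := by
  obtain ⟨y, -, hy⟩ := exists_mem_cyclicPairs_left (hc.2 i)
  exact Set.ncard_eq_one.2
    ⟨y, Set.eq_singleton_iff_unique_mem.2 ⟨hy, fun _ h => eq_of_mem_cyclicPairs_left hc.1 h hy⟩⟩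

theorem IsHamCycle.ncard_pred {c : List V} (hc : IsHamCycle c) (j : V) :
    {x | (x, j) ∈ cyclicPairs c}.ncard = 1 := by
  obtain ⟨y, hy⟩ := exists_mem_cyclicPairs_right (hc.2 j)
  exact Set.ncard_eq_one.2
    ⟨y, Set.eq_singleton_iff_unique_mem.2 ⟨hy, fun _ h => eq_of_mem_cyclicPairs_right hc.1 h hy⟩⟩

variable [Fintype V]

theorem IsHamCycle.length_eq {c : List V} (h : IsHamCycle c) : c.length = Fintype.card V := by
  classical
  rw [← List.toFinset_card_of_nodup h.1, ← Finset.card_univ]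
  congr 1
  ext v
  simpa using h.2 v

theorem circuitDelay_le_mul_cycleTime {A : V → V → Prop} {d : V → V → ℝ} {c : List V}
    (hc : IsElemCircuit A c) : circuitDelay d c ≤ c.length * cycleTime A d := by
  have hpos : (0 : ℝ) < c.length := by
    have := hc.1
    exact_mod_cast (by lia : 0 < c.length)
  rw [← div_le_iff₀' hpos]
  refine le_csSup (Set.Finite.bddAbove ?_) ⟨c, hc, rfl⟩
  refine ((List.finite_length_le V (Fintype.card V)).image
    fun c => circuitDelay d c / (c.length : ℝ)).subset ?_
  rintro _ ⟨c, hc, rfl⟩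
  exact ⟨c, hc.2.1.length_le_card, rfl⟩

theorem StronglyConnected.le_card_mul_cycleTime {A : V → V → Prop} (hA : StronglyConnected A)
    {d : V → V → ℝ} (hd : ∀ i j, 0 ≤ d i j) {i j : V} (hij : A i j) (hne : i ≠ j) :
    d i j ≤ Fintype.card V * cycleTime A d := by
  obtain ⟨c, hc, hmem⟩ := hA.exists_circuit hij hne
  have hle := circuitDelay_le_mul_cycleTime (d := d) hc
  have hpos : (0 : ℝ) < c.length := by
    have := hc.1
    exact_mod_cast (by lia : 0 < c.length)
  have hτ : 0 ≤ cycleTime A d :=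
    nonneg_of_mul_nonneg_right ((circuitDelay_nonneg hd c).trans hle) hpos
  have hlen : (c.length : ℝ) ≤ Fintype.card V := by exact_mod_cast hc.2.1.length_le_card
  exact (le_circuitDelay hd hmem).trans (hle.trans (mul_le_mul_of_nonneg_right hlen hτ))

/-- If the arcs of a strongly connected digraph have length at most `K` in a metric, there is a
tour of length at most `2 (N - 1) K`. -/
theorem StronglyConnected.exists_isHamCycle_le {A : V → V → Prop} (hA : StronglyConnected A)
    (hN : 2 ≤ Fintype.card V) {d : V → V → ℝ} (hsymm : ∀ i j, d i j = d j i)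
    (htri : ∀ i j k, i ≠ j → i ≠ k → j ≠ k → d i j ≤ d i k + d k j) {K : ℝ}
    (hK : ∀ i j, A i j → i ≠ j → d i j ≤ K) :
    ∃ c : List V, IsHamCycle c ∧ circuitDelay d c ≤ 2 * ((Fintype.card V : ℝ) - 1) * K := by
  have key : ∀ n : ℕ, 2 ≤ n → n ≤ Fintype.card V → ∃ c : List V, c.Nodup ∧ c.length = n ∧
      circuitDelay d c ≤ 2 * ((n : ℝ) - 1) * K := by
    intro n hn
    induction n, hn using Nat.le_induction with
    | base =>
      intro _
      obtain ⟨x, y, hxy⟩ := Fintype.exists_pair_of_one_lt_card hN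
      obtain ⟨u, rfl, v, hv, huv⟩ :=
        hA.exists_leaving (Set.mem_singleton x) (show y ∉ ({x} : Set V) from hxy.symm)
      have hne : u ≠ v := fun h => hv h.symm
      refine ⟨[u, v], by simpa using hne, rfl, ?_⟩
      have := hK u v huv hne
      simp only [circuitDelay, cyclicPairs_cons, List.cons_append, List.nil_append,
        List.zip_cons_cons, List.zip_nil_left, List.map_cons, List.map_nil, List.sum_cons,
        List.sum_nil]
      push_cast
      linarith [hsymm u v]
    | succ n hn ih =>
      intro hlt
      obtain ⟨c, hnd, hlen, hc⟩ := ih (by lia)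
      obtain ⟨y, hy⟩ : ∃ y, y ∉ c := by
        by_contra! h
        have := IsHamCycle.length_eq ⟨hnd, h⟩
        lia
      obtain ⟨x, hx⟩ := List.exists_mem_of_length_pos (l := c) (by lia)
      obtain ⟨u, hu, v, hv, huv⟩ := hA.exists_leaving (S := {z | z ∈ c}) hx hy
      obtain ⟨t, ht⟩ := exists_isRotated_cons hu
      rw [circuitDelay_eq_of_perm d (cyclicPairs_perm_of_isRotated ht)] at hc
      have hlen' := ht.perm.length_eq
      replace hnd := ht.nodup_iff.1 hnd
      replace hv : v ∉ u :: t := fun h => hv (ht.mem_iff.2 h)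
      cases t with
      | nil => simp at hlen'; lia
      | cons w t =>
        have hnd' : (u :: v :: w :: t).Nodup := by
          simp only [List.nodup_cons, List.mem_cons, not_or] at hnd hv ⊢
          tauto
        refine ⟨u :: v :: w :: t, hnd', by simp at hlen' ⊢; lia, ?_⟩
        have h₁ := circuitDelay_insert_le hsymm htri hnd'
        have h₂ := hK u v huv (fun h => hv (by simp [h]))
        push_cast
        linarith
  obtain ⟨c, hnd, hlen, hc⟩ := key _ hN le_rfl
  refine ⟨c, ⟨hnd, fun v => ?_⟩, hc⟩
  by_contra hv
  have := (List.nodup_cons.2 ⟨hv, hnd⟩).length_le_card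
  simp only [List.length_cons] at this
  lia

/-- The only elementary circuits of a Hamiltonian cycle are its rotations, so its cycle time is
the mean delay of its arcs. -/
theorem cycleTime_hamCycle {c : List V} (hc : IsHamCycle c) (hN : 2 ≤ Fintype.card V)
    (d : V → V → ℝ) :
    cycleTime (fun i j => (i, j) ∈ cyclicPairs c) d = circuitDelay d c / (Fintype.card V : ℝ) := by
  have hset : {x : ℝ | ∃ c' : List V, IsElemCircuit (fun i j => (i, j) ∈ cyclicPairs c) c' ∧
      x = circuitDelay d c' / (c'.length : ℝ)} = {circuitDelay d c / (Fintype.card V : ℝ)} := by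
    ext x
    simp only [Set.mem_ofPred_eq, Set.mem_singleton_iff]
    constructor
    · rintro ⟨e, ⟨hlen, hnd, harc⟩, rfl⟩
      obtain ⟨x, hx⟩ := List.exists_mem_of_length_pos (l := e) (by lia)
      have he : IsHamCycle e := by
        refine ⟨hnd, fun v => mem_of_forall_cyclicPairs (S := {z | z ∈ e}) (hc.2 x) hx ?_ (hc.2 v)⟩
        rintro ⟨a, b⟩ hab ha
        obtain ⟨y, hy, hay⟩ := exists_mem_cyclicPairs_left (show a ∈ e from ha)
        rwa [eq_of_mem_cyclicPairs_left hc.1 hab (harc _ hay)]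
      have hperm : (cyclicPairs e).Perm (cyclicPairs c) :=
        (List.subperm_of_subset (nodup_cyclicPairs hnd) fun p hp => harc p hp).perm_of_length_le
          (by rw [length_cyclicPairs, length_cyclicPairs, hc.length_eq, he.length_eq])
      rw [circuitDelay_eq_of_perm d hperm, he.length_eq]
    · rintro rfl
      exact ⟨c, ⟨by rwa [hc.length_eq], hc.1, fun _ hp => hp⟩, by rw [hc.length_eq]⟩
  rw [cycleTime, hset, csSup_singleton]

end CyclicPairs

/-- **Prop. 6.** Node-capacitated networks: arc delays in a spanning
subdigraph `G` are `d_o^G(i,j) = s·T_c(i) + l(i,j) + M/min(C_UP(i)/outdeg_G(i),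
C_DN(j)/indeg_G(j), A(i,j))`, and `d'(i,j) = s·T_c(i) + l(i,j) +
M/min(C_UP(i), C_DN(j), A(i,j))` is assumed Euclidean. If `Ĉ` is a Hamiltonian cycle
whose total `d'`-delay is within a factor `3/2` of the optimal tour (the Christofides
guarantee), then the cycle time of the overlay `Ĉ` equals `d'(Ĉ)/N` and is at most
`3N·τ*`, where `τ*` is the minimum cycle time over strongly connected spanning
subdigraphs. -/
theorem christofides_node_capacitated {V : Type*} [Fintype V]
    (hN : 2 ≤ Fintype.card V)
    (s M : ℝ) (hs : 0 ≤ s) (hM : 0 < M)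
    (Tc CUP CDN : V → ℝ)
    (hTc : ∀ i, 0 ≤ Tc i) (hCUP : ∀ i, 0 < CUP i) (hCDN : ∀ i, 0 < CDN i)
    (l Av : V → V → ℝ) (hl : ∀ i j, 0 ≤ l i j) (hAv : ∀ i j, 0 < Av i j)
    (dG : (V → V → Prop) → V → V → ℝ)
    (hdG : ∀ (A : V → V → Prop) (i j : V), dG A i j =
      s * Tc i + l i j +
        M / min (CUP i / ({x : V | A i x}.ncard : ℝ))
            (min (CDN j / ({x : V | A x j}.ncard : ℝ)) (Av i j)))
    (d' : V → V → ℝ)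
    (hd' : ∀ i j : V, d' i j = s * Tc i + l i j + M / min (CUP i) (min (CDN j) (Av i j)))
    (hsymm : ∀ i j : V, d' i j = d' j i)
    (htri : ∀ i j k : V, i ≠ j → i ≠ k → j ≠ k → d' i j ≤ d' i k + d' k j)
    (τstar : ℝ)
    (hτ : τstar = sInf {x : ℝ | ∃ A : V → V → Prop, (∀ i j, A i j → i ≠ j) ∧
      StronglyConnected A ∧ x = cycleTime A (dG A)})
    (Chat : List V) (hHam : IsHamCycle Chat)
    (happrox : circuitDelay d' Chat ≤
      (3 / 2) * sInf {x : ℝ | ∃ c : List V, IsHamCycle c ∧ x = circuitDelay d' c}) :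
    cycleTime (fun i j => (i, j) ∈ cyclicPairs Chat)
        (dG (fun i j => (i, j) ∈ cyclicPairs Chat)) =
      circuitDelay d' Chat / (Fintype.card V : ℝ) ∧
    circuitDelay d' Chat / (Fintype.card V : ℝ) ≤ 3 * (Fintype.card V : ℝ) * τstar := by
  have hd'nonneg : ∀ i j, 0 ≤ d' i j := fun i j => by
    rw [hd']
    have := hTc i
    have := hl i j
    have : 0 < min (CUP i) (min (CDN j) (Av i j)) :=
      lt_min (hCUP i) (lt_min (hCDN j) (hAv i j))
    positivity
  have hdGnonneg : ∀ A i j, 0 ≤ dG A i j := fun A i j => by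
    rw [hdG]
    have := hTc i
    have := hl i j
    have : 0 ≤ min (CUP i / ({x : V | A i x}.ncard : ℝ))
        (min (CDN j / ({x : V | A x j}.ncard : ℝ)) (Av i j)) :=
      le_min (div_nonneg (hCUP i).le (Nat.cast_nonneg _))
        (le_min (div_nonneg (hCDN j).le (Nat.cast_nonneg _)) (hAv i j).le)
    positivity
  have hle : ∀ A i j, A i j → d' i j ≤ dG A i j := fun A i j hij => by
    have hout : (1 : ℝ) ≤ ({x : V | A i x}.ncard : ℝ) := by
      exact_mod_cast (Set.ncard_pos (Set.toFinite _)).2 ⟨j, hij⟩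
    have hin : (1 : ℝ) ≤ ({x : V | A x j}.ncard : ℝ) := by
      exact_mod_cast (Set.ncard_pos (Set.toFinite _)).2 ⟨i, hij⟩
    rw [hd', hdG]
    gcongr
    · exact lt_min (div_pos (hCUP i) (by linarith))
        (lt_min (div_pos (hCDN j) (by linarith)) (hAv i j))
    · exact div_le_self (hCUP i).le hout
    · exact div_le_self (hCDN j).le hin
  have hcard : (2 : ℝ) ≤ Fintype.card V := by exact_mod_cast hN
  constructor
  · have hdel : dG (fun i j => (i, j) ∈ cyclicPairs Chat) = d' := by
      funext i j
      rw [hdG, hd', hHam.ncard_succ, hHam.ncard_pred]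
      simp
    rw [hdel, cycleTime_hamCycle hHam hN]
  · rw [mul_comm, ← div_le_iff₀ (by positivity), hτ]
    refine le_csInf ⟨_, fun i j => i ≠ j, fun _ _ h => h, fun i j => ?_, rfl⟩ ?_
    · by_cases h : i = j
      · rw [h]
      · exact .single h
    · rintro _ ⟨A, -, hA, rfl⟩
      set τ := cycleTime A (dG A)
      have hK : ∀ i j, A i j → i ≠ j → d' i j ≤ Fintype.card V * τ := fun i j hij hne =>
        (hle A i j hij).trans (hA.le_card_mul_cycleTime (hdGnonneg A) hij hne)
      obtain ⟨c, hc, hcle⟩ := hA.exists_isHamCycle_le hN hsymm htri hK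
      have hopt : sInf {x : ℝ | ∃ c : List V, IsHamCycle c ∧ x = circuitDelay d' c} ≤
          circuitDelay d' c := by
        refine csInf_le ⟨0, ?_⟩ ⟨c, hc, rfl⟩
        rintro _ ⟨c, -, rfl⟩
        exact circuitDelay_nonneg hd'nonneg c
      have hτ0 : 0 ≤ Fintype.card V * τ := by
        have := (circuitDelay_nonneg hd'nonneg c).trans hcle
        exact nonneg_of_mul_nonneg_right this (by linarith)
      rw [div_div, div_le_iff₀ (by positivity)]
      nlinarith
end

section
/- Let n ≥ 2, let V = {1, …, n+1}, and let d be the shortest-path metric on the weighted path with edge weights 1 between i and i+1 for 1 ≤ i ≤ n−1 and weight n between n and n+1 (so d(i,j) = |i−j| for i, j ≤ n, and d(i, n+1) = (n−i) + n for i ≤ n). Then d is symmetric and satisfies the triangle inequality; every connected spanning undirected overlay on V (bidirected subgraph of the complete graph with delays d) has cycle time at least n; and the directed ring 1→2→⋯→n→(n+1)→1 is a strongly connected spanning subdigraph with cycle time (4n−2)/(n+1) < 4. Hence the ratio between the minimum cycle time over undirected overlays and the cycle time of this directed overlay is at least n(n+1)/(4n−2), which tends to infinity with n. -/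
/-- The directed ring `1 → 2 → ⋯ → n → (n+1) → 1` (0-indexed: `i → i+1` and `n → 0`)
on `n+1` vertices. -/
def dirRing (n : ℕ) : Fin (n + 1) → Fin (n + 1) → Prop := fun i j =>
  (j.val = i.val + 1) ∨ (i.val = n ∧ j.val = 0)

lemma bddAbove_circuitMeans {V : Type*} [Fintype V] (A : V → V → Prop) (d : V → V → ℝ) :
    BddAbove {x : ℝ | ∃ c : List V, IsElemCircuit A c ∧
      x = circuitDelay d c / (c.length : ℝ)} := by
  have hfin : {c : List V | c.Nodup}.Finite :=
    (List.finite_length_le V (Fintype.card V)).subset fun c hc => List.Nodup.length_le_card hc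
  refine ((hfin.image fun c => circuitDelay d c / (c.length : ℝ)).subset ?_).bddAbove
  rintro x ⟨c, hc, rfl⟩
  exact ⟨c, hc.2.1, rfl⟩

/-- Any pair of opposite arcs bounds the cycle time from below. -/
lemma le_cycleTime_of_adj {V : Type*} [Fintype V] (H : SimpleGraph V) (d : V → V → ℝ)
    {u v : V} (h : H.Adj u v) : (d u v + d v u) / 2 ≤ cycleTime H.Adj d := by
  refine le_csSup (bddAbove_circuitMeans _ d) ⟨[u, v], ⟨by simp, by simp [h.ne], ?_⟩, ?_⟩
  · simp [cyclicPairs, h, h.symm]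
  · simp [circuitDelay, cyclicPairs]

lemma dirRing_iff {n : ℕ} (i j : Fin (n + 1)) : dirRing n i j ↔ j = i + 1 := by
  induction i using Fin.lastCases with
  | last =>
    have := j.isLt
    rw [Fin.last_add_one, ← Fin.val_eq_zero_iff, dirRing, Fin.val_last]
    omega
  | cast i =>
    have := i.isLt
    simp only [dirRing, Fin.val_castSucc, Fin.coeSucc_eq_succ, Fin.ext_iff, Fin.val_succ]
    omega

lemma stronglyConnected_dirRing (n : ℕ) : StronglyConnected (dirRing n) := by
  have from_zero (j : Fin (n + 1)) : Relation.ReflTransGen (dirRing n) 0 j := by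
    induction j using Fin.induction with
    | zero => exact .refl
    | succ j ih => exact ih.tail (Or.inl (by simp))
  have to_last (j : Fin (n + 1)) : Relation.ReflTransGen (dirRing n) j (Fin.last n) := by
    induction j using Fin.reverseInduction with
    | last => exact .refl
    | cast j ih => exact ih.head (Or.inl (by simp))
  intro i j
  exact ((to_last i).tail (Or.inr (by simp))).trans (from_zero j)

lemma rotate_one_eq_map_of_cyclicPairs {V : Type*} {l : List V} {f : V → V}
    (h : ∀ p ∈ cyclicPairs l, p.2 = f p.1) : l.rotate 1 = l.map f := by
  refine List.ext_getElem (by simp) fun k h₁ h₂ => ?_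
  have hk : k < l.length := by simpa using h₂
  have hmem : (l[k], (l.rotate 1)[k]) ∈ cyclicPairs l := by
    refine List.mem_iff_getElem.mpr ⟨k, by simpa [cyclicPairs] using hk, ?_⟩
    simp [cyclicPairs]
  simpa using h _ hmem

lemma mem_of_isElemCircuit_dirRing {n : ℕ} {c : List (Fin (n + 1))}
    (hc : IsElemCircuit (dirRing n) c) (j : Fin (n + 1)) : j ∈ c := by
  have hrot : c.rotate 1 = c.map (· + 1) :=
    rotate_one_eq_map_of_cyclicPairs fun p hp => (dirRing_iff _ _).1 (hc.2.2 p hp)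
  obtain ⟨i, hi⟩ := List.exists_mem_of_length_pos (show 0 < c.length by have := hc.1; omega)
  induction stronglyConnected_dirRing n i j with
  | refl => exact hi
  | tail _ hbc ih =>
    rw [(dirRing_iff _ _).1 hbc, ← List.mem_rotate (n := 1), hrot]
    exact List.mem_map_of_mem ih

/-- The elementary circuits of the directed ring are all Hamiltonian. -/
lemma circuitDelay_div_length_dirRing {n : ℕ} (d : Fin (n + 1) → Fin (n + 1) → ℝ)
    {c : List (Fin (n + 1))} (hc : IsElemCircuit (dirRing n) c) :
    circuitDelay d c / (c.length : ℝ) = (∑ i, d i (i + 1)) / ((n : ℝ) + 1) := by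
  have hrot : c.rotate 1 = c.map (· + 1) :=
    rotate_one_eq_map_of_cyclicPairs fun p hp => (dirRing_iff _ _).1 (hc.2.2 p hp)
  have huniv : c.toFinset = Finset.univ := by
    ext j
    simpa using mem_of_isElemCircuit_dirRing hc j
  have hlen : c.length = n + 1 := by
    rw [← List.toFinset_card_of_nodup hc.2.1, huniv, Finset.card_fin]
  have hdelay : circuitDelay d c = ∑ i, d i (i + 1) := by
    rw [← huniv, List.sum_toFinset _ hc.2.1, circuitDelay, cyclicPairs, hrot,
      List.zip_map_right, List.map_map]
    simp [Function.comp_def, List.zip_eq_zipWith, List.zipWith_self]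
  rw [hdelay, hlen]
  push_cast
  rfl

lemma isElemCircuit_finRange {n : ℕ} (hn : 1 ≤ n) :
    IsElemCircuit (dirRing n) (List.finRange (n + 1)) := by
  refine ⟨by simpa using hn, List.nodup_finRange _, fun p hp => ?_⟩
  obtain ⟨k, hk, rfl⟩ := List.mem_iff_getElem.mp hp
  have hk' : k < n + 1 := by simpa [cyclicPairs] using hk
  simp only [cyclicPairs, List.getElem_zip, List.getElem_rotate, List.getElem_finRange,
    List.length_finRange, dirRing, Fin.val_cast]
  rcases Nat.lt_succ_iff_lt_or_eq.mp hk' with h | h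
  · exact Or.inl (Nat.mod_eq_of_lt (by omega))
  · exact Or.inr ⟨h, by simp [h]⟩

lemma cycleTime_dirRing {n : ℕ} (hn : 1 ≤ n) (d : Fin (n + 1) → Fin (n + 1) → ℝ) :
    cycleTime (dirRing n) d = (∑ i, d i (i + 1)) / ((n : ℝ) + 1) := by
  have hset : {x : ℝ | ∃ c : List (Fin (n + 1)), IsElemCircuit (dirRing n) c ∧
      x = circuitDelay d c / (c.length : ℝ)} = {(∑ i, d i (i + 1)) / ((n : ℝ) + 1)} := by
    ext x
    constructor
    · rintro ⟨c, hc, rfl⟩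
      exact circuitDelay_div_length_dirRing d hc
    · rintro rfl
      exact ⟨_, isElemCircuit_finRange hn,
        (circuitDelay_div_length_dirRing d (isElemCircuit_finRange hn)).symm⟩
  rw [cycleTime, hset, csSup_singleton]

lemma tendsto_mul_add_one_div_atTop :
    Filter.Tendsto (fun m : ℕ => (m : ℝ) * ((m : ℝ) + 1) / (4 * (m : ℝ) - 2))
      Filter.atTop Filter.atTop := by
  refine Filter.tendsto_atTop_mono' _ ?_
    (tendsto_natCast_atTop_atTop.atTop_div_const (show (0 : ℝ) < 4 by norm_num))
  filter_upwards [Filter.eventually_ge_atTop 1] with m hm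
  have hm' : (1 : ℝ) ≤ m := by exact_mod_cast hm
  rw [div_le_div_iff₀ (by norm_num) (by linarith)]
  nlinarith

/-- **Appendix C example.** On the vertex set `{1, …, n+1}` with the
shortest-path metric of the weighted path (unit weights on the first `n-1` edges and
weight `n` on the last edge, written here 0-indexed): the metric is symmetric and
satisfies the triangle inequality; every connected spanning undirected overlay has
cycle time at least `n`; the directed ring is strongly connected with cycle time
`(4n-2)/(n+1) < 4`; hence the ratio between the minimum undirected overlay cycle time
and the directed ring's cycle time is at least `n(n+1)/(4n-2)`, which tends to
infinity with `n`. -/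
theorem directed_beats_undirected_example (n : ℕ) (hn : 2 ≤ n)
    (d : Fin (n + 1) → Fin (n + 1) → ℝ)
    (hd : ∀ i j : Fin (n + 1), d i j =
      if i.val < n ∧ j.val < n then |(i.val : ℝ) - (j.val : ℝ)|
      else if i.val < n ∧ j.val = n then 2 * (n : ℝ) - 1 - (i.val : ℝ)
      else if i.val = n ∧ j.val < n then 2 * (n : ℝ) - 1 - (j.val : ℝ)
      else 0) :
    ((∀ i j : Fin (n + 1), d i j = d j i) ∧
      (∀ i j k : Fin (n + 1), i ≠ j → i ≠ k → j ≠ k → d i j ≤ d i k + d k j)) ∧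
    (∀ H : SimpleGraph (Fin (n + 1)), H.Connected → (n : ℝ) ≤ cycleTime H.Adj d) ∧
    (StronglyConnected (dirRing n) ∧
      cycleTime (dirRing n) d = (4 * (n : ℝ) - 2) / ((n : ℝ) + 1) ∧
      (4 * (n : ℝ) - 2) / ((n : ℝ) + 1) < 4) ∧
    ((n : ℝ) * ((n : ℝ) + 1) / (4 * (n : ℝ) - 2) ≤
      sInf {x : ℝ | ∃ H : SimpleGraph (Fin (n + 1)), H.Connected ∧ x = cycleTime H.Adj d} /
        cycleTime (dirRing n) d) ∧
    Filter.Tendsto (fun m : ℕ => (m : ℝ) * ((m : ℝ) + 1) / (4 * (m : ℝ) - 2))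
      Filter.atTop Filter.atTop := by
  have hn' : (2 : ℝ) ≤ n := by exact_mod_cast hn
  have hund : ∀ H : SimpleGraph (Fin (n + 1)), H.Connected → (n : ℝ) ≤ cycleTime H.Adj d := by
    intro H hH
    have : Nontrivial (Fin (n + 1)) := Fin.nontrivial_iff_two_le.mpr (by omega)
    obtain ⟨i, hi⟩ := hH.preconnected.exists_adj_of_nontrivial (Fin.last n)
    have hin : i.val < n := Fin.val_lt_last hi.ne'
    refine le_trans ?_ (le_cycleTime_of_adj H d hi)
    have hin' : (i.val : ℝ) + 1 ≤ n := by exact_mod_cast hin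
    rw [hd, hd]
    simp only [Fin.val_last, lt_irrefl, hin, and_true, and_false, false_and, if_true,
      if_false]
    linarith
  have hring : cycleTime (dirRing n) d = (4 * (n : ℝ) - 2) / ((n : ℝ) + 1) := by
    rw [cycleTime_dirRing (by omega)]
    congr 1
    obtain ⟨m, rfl⟩ : ∃ m, n = m + 1 := ⟨n - 1, by omega⟩
    rw [Fin.sum_univ_castSucc, Fin.sum_univ_castSucc]
    have hunit (i : Fin m) : d i.castSucc.castSucc (i.castSucc.castSucc + 1) = 1 := by
      rw [Fin.coeSucc_eq_succ, hd, if_pos (by simp)]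
      simp
    have hlong : d (Fin.last m).castSucc ((Fin.last m).castSucc + 1) = m + 1 := by
      rw [Fin.coeSucc_eq_succ, hd]
      simp
      ring
    have hback : d (Fin.last (m + 1)) (Fin.last (m + 1) + 1) = 2 * m + 1 := by
      rw [Fin.last_add_one, hd]
      simp
      ring
    simp only [hunit, hlong, hback, Finset.sum_const, Finset.card_fin, nsmul_eq_mul]
    push_cast
    ring
  have hlt : (4 * (n : ℝ) - 2) / ((n : ℝ) + 1) < 4 := by
    rw [div_lt_iff₀ (by linarith)]
    linarith
  refine ⟨⟨fun i j => ?_, fun i j k _ _ _ => ?_⟩, hund,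
    ⟨stronglyConnected_dirRing n, hring, hlt⟩, ?_, tendsto_mul_add_one_div_atTop⟩
  · rw [hd, hd, abs_sub_comm]
    have := i.isLt
    have := j.isLt
    split_ifs <;> first | rfl | omega
  · have hle (i : Fin (n + 1)) (h : i.val < n) : (i.val : ℝ) + 1 ≤ n := by exact_mod_cast h
    have hi := hle i
    have hj := hle j
    have hk := hle k
    rw [hd, hd, hd]
    have := i.isLt
    have := j.isLt
    have := k.isLt
    have := abs_sub_le (i.val : ℝ) k.val j.val
    have := le_abs_self ((i.val : ℝ) - k.val)
    have := neg_abs_le ((i.val : ℝ) - k.val)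
    have := le_abs_self ((k.val : ℝ) - j.val)
    have := neg_abs_le ((k.val : ℝ) - j.val)
    split_ifs <;> first | omega | grind
  · have hinf : (n : ℝ) ≤ sInf {x : ℝ | ∃ H : SimpleGraph (Fin (n + 1)), H.Connected ∧
        x = cycleTime H.Adj d} := by
      refine le_csInf ⟨_, ⊤, SimpleGraph.connected_top, rfl⟩ ?_
      rintro x ⟨H, hH, rfl⟩
      exact hund H hH
    rw [hring, div_div_eq_mul_div]
    gcongr
    linarith
end
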